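/- arXiv:cs/0607020 — 2 statements merged into one kernel-verified Lean document; each statement's English description precedes it below -/
import Mathlib

section
/- Let M be a real random variable whose law has a symmetric LLR density g. Then E[tanh(|M|/2)] = ∫_0^∞ (1 - e^{-m}) g(m) dm. -/
open MeasureTheory

/-- `(1 + exp (-x)) * tanh (x / 2) = 1 - exp (-x)`. -/
theorem one_add_exp_neg_mul_tanh_half (x : ℝ) :
    (1 + Real.exp (-x)) * Real.tanh (x / 2) = 1 - Real.exp (-x) := by
  have hx : Real.exp (-x) = Real.exp (-(x / 2)) * Real.exp (-(x / 2)) := by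
    rw [← Real.exp_add]
    ring_nf
  have hprod : Real.exp (x / 2) * Real.exp (-(x / 2)) = 1 := by
    rw [← Real.exp_add, add_neg_cancel, Real.exp_zero]
  have hpos : 0 < Real.exp (x / 2) + Real.exp (-(x / 2)) := by positivity
  rw [Real.tanh_eq, hx, ← mul_div_assoc, div_eq_iff hpos.ne']
  linear_combination (2 * Real.exp (-(x / 2))) * hprod

/-- If `M` is a real random variable whose law has a symmetric
LLR density `g`, then `E[tanh (|M| / 2)] = ∫_0^∞ (1 - exp (-m)) * g m dm`. -/
theorem expectation_tanh_abs_half_eq_integral_Ioi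
    {Ω : Type*} [MeasurableSpace Ω] (ℙ : Measure Ω) [IsProbabilityMeasure ℙ]
    (M : Ω → ℝ) (hM : Measurable M) (g : ℝ → ℝ)
    (hg_meas : Measurable g) (hg_nonneg : ∀ m, 0 ≤ g m)
    (hg_one : ∫ m, g m = 1)
    (hg_sym : ∀ m : ℝ, g (-m) = Real.exp (-m) * g m)
    (hlaw : Measure.map M ℙ = volume.withDensity (fun m => ENNReal.ofReal (g m))) :
    ∫ ω, Real.tanh (|M ω| / 2) ∂ℙ
      = ∫ m in Set.Ioi (0 : ℝ), (1 - Real.exp (-m)) * g m := by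
  have hg_int : Integrable g := by
    by_contra h
    simp [integral_undef h] at hg_one
  have htanh : Continuous fun m : ℝ => Real.tanh (|m| / 2) := by
    simp only [Real.tanh_eq_sinh_div_cosh]
    exact (Real.continuous_sinh.comp (by fun_prop)).div
      (Real.continuous_cosh.comp (by fun_prop)) fun m => (Real.cosh_pos _).ne'
  have hint : Integrable fun m => g m * Real.tanh (|m| / 2) :=
    hg_int.mul_bdd (c := 1) htanh.aestronglyMeasurable
      (.of_forall fun m => (Real.abs_tanh_lt_one _).le)
  have hneg : ∫ m in Set.Iic (0 : ℝ), g m * Real.tanh (|m| / 2)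
      = ∫ m in Set.Ioi (0 : ℝ), g (-m) * Real.tanh (|m| / 2) := by
    simpa using (integral_comp_neg_Ioi 0 fun m : ℝ => g m * Real.tanh (|m| / 2)).symm
  have hint_neg : Integrable fun m => g (-m) * Real.tanh (|m| / 2) := by
    simpa using hint.comp_neg
  calc ∫ ω, Real.tanh (|M ω| / 2) ∂ℙ
      = ∫ m, Real.tanh (|m| / 2) ∂(Measure.map M ℙ) :=
        (integral_map hM.aemeasurable htanh.aestronglyMeasurable).symm
    _ = ∫ m, g m * Real.tanh (|m| / 2) := by
        rw [hlaw, integral_withDensity_eq_integral_toReal_smul hg_meas.ennreal_ofReal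
          (.of_forall fun _ => ENNReal.ofReal_lt_top)]
        simp only [ENNReal.toReal_ofReal (hg_nonneg _), smul_eq_mul]
    _ = (∫ m in Set.Iic (0 : ℝ), g m * Real.tanh (|m| / 2))
          + ∫ m in Set.Ioi (0 : ℝ), g m * Real.tanh (|m| / 2) :=
        (intervalIntegral.integral_Iic_add_Ioi hint.integrableOn hint.integrableOn).symm
    _ = ∫ m in Set.Ioi (0 : ℝ),
          (g (-m) * Real.tanh (|m| / 2) + g m * Real.tanh (|m| / 2)) := by
        rw [hneg, integral_add hint_neg.integrableOn hint.integrableOn]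
    _ = ∫ m in Set.Ioi (0 : ℝ), (1 - Real.exp (-m)) * g m := by
        refine setIntegral_congr_fun measurableSet_Ioi fun m hm => ?_
        simp only [hg_sym, abs_of_pos (Set.mem_Ioi.mp hm)]
        linear_combination g m * one_add_exp_neg_mul_tanh_half m
end

section
/- Let M₁ and M₂ be independent real random variables with symmetric LLR densities g₁ and g₂ respectively. Then E[tanh(|M₁ + M₂|/2)] = ∫∫_{m₁ + m₂ ≥ 0} (1 - e^{-(m₁+m₂)}) g₁(m₁) g₂(m₂) dm₁ dm₂. -/
open MeasureTheory ProbabilityTheory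

lemma tanh_half_mul_one_add_exp_neg (s : ℝ) :
    Real.tanh (s / 2) * (1 + Real.exp (-s)) = 1 - Real.exp (-s) := by
  have h : Real.exp (-s) = Real.exp (-(s / 2)) * Real.exp (-(s / 2)) := by
    rw [← Real.exp_add]; ring_nf
  have h' : Real.exp (s / 2) * Real.exp (-(s / 2)) = 1 := by
    rw [← Real.exp_add]; simp
  have hpos : Real.exp (s / 2) + Real.exp (-(s / 2)) ≠ 0 := by positivity
  rw [Real.tanh_eq, h, div_mul_eq_mul_div, div_eq_iff hpos]
  linear_combination (2 * Real.exp (-(s / 2))) * h'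

lemma continuous_tanh_real : Continuous Real.tanh := by
  have : Real.tanh = fun x => Real.sinh x / Real.cosh x := funext Real.tanh_eq_sinh_div_cosh
  rw [this]
  exact Real.continuous_sinh.div Real.continuous_cosh fun x => (Real.cosh_pos x).ne'

/-- If `h (-p) = exp (-(p.1 + p.2)) * h p`, the half-plane `p.1 + p.2 < 0` can be folded onto
the opposite one in the integral of `tanh (|p.1 + p.2| / 2) * h p`. -/
lemma integral_tanh_abs_half_mul_eq_setIntegral (h : ℝ × ℝ → ℝ) (hint : Integrable h)
    (hsym : ∀ p, h (-p) = Real.exp (-(p.1 + p.2)) * h p) :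
    ∫ p, Real.tanh (|p.1 + p.2| / 2) * h p
      = ∫ p in {p : ℝ × ℝ | 0 ≤ p.1 + p.2}, (1 - Real.exp (-(p.1 + p.2))) * h p := by
  set A : Set (ℝ × ℝ) := {p | 0 ≤ p.1 + p.2} with hA
  set F : ℝ × ℝ → ℝ := fun p => Real.tanh (|p.1 + p.2| / 2) * h p with hF
  have hAm : MeasurableSet A := measurableSet_le (by fun_prop) (by fun_prop)
  have hFint : Integrable F := by
    refine hint.bdd_mul (c := 1) ?_ (.of_forall fun p => ?_)
    · exact (continuous_tanh_real.comp (by fun_prop)).aestronglyMeasurable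
    · exact (Real.abs_tanh_lt_one _).le
  have hfold : ∀ p, Aᶜ.indicator F (-p) =
      A.indicator (fun p => Real.exp (-(p.1 + p.2)) * F p) p := by
    intro p
    have habs : |(-p).1 + (-p).2| = |p.1 + p.2| := by
      rw [← abs_neg]; simp only [Prod.fst_neg, Prod.snd_neg]; ring_nf
    have hval : F (-p) = Real.exp (-(p.1 + p.2)) * F p := by
      simp only [hF, habs, hsym]; ring
    by_cases hp : -p ∈ Aᶜ
    · have hp' : p ∈ A := by
        simp only [hA, Set.mem_compl_iff, Set.mem_ofPred_eq, Prod.fst_neg, Prod.snd_neg] at hp ⊢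
        linarith
      rw [Set.indicator_of_mem hp, Set.indicator_of_mem hp', hval]
    · rw [Set.indicator_of_notMem hp]
      by_cases hp' : p ∈ A
      · have h0 : p.1 + p.2 = 0 := by
          simp only [hA, Set.mem_compl_iff, Set.mem_ofPred_eq, Prod.fst_neg, Prod.snd_neg,
            not_not] at hp hp'
          linarith
        simp [Set.indicator_of_mem hp', hF, h0]
      · rw [Set.indicator_of_notMem hp']
  have hind : Integrable (A.indicator fun p => Real.exp (-(p.1 + p.2)) * F p) :=
    ((hFint.indicator hAm.compl).comp_neg).congr (.of_forall hfold)
  have hneg : ∫ p in Aᶜ, F p = ∫ p in A, Real.exp (-(p.1 + p.2)) * F p := by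
    rw [← integral_indicator hAm.compl, ← integral_indicator hAm,
      ← integral_neg_eq_self (Aᶜ.indicator F)]
    exact integral_congr_ae (.of_forall hfold)
  rw [← integral_add_compl hAm hFint, hneg,
    ← integral_add hFint.integrableOn ((integrable_indicator_iff hAm).1 hind)]
  refine setIntegral_congr_fun hAm fun p hp => ?_
  simp only [hF, abs_of_nonneg (show 0 ≤ p.1 + p.2 from hp)]
  rw [← tanh_half_mul_one_add_exp_neg]
  ring

/-- If `M₁` and `M₂` are independent real random variables with
symmetric LLR densities `g₁` and `g₂`, then
`E[tanh(|M₁ + M₂|/2)] = ∫∫_{m₁ + m₂ ≥ 0} (1 - exp (-(m₁ + m₂))) g₁ m₁ g₂ m₂`. -/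
theorem tanh_abs_half_sum_expectation_eq_double_integral
    {Ω : Type*} [MeasurableSpace Ω] (μ : Measure Ω) [IsProbabilityMeasure μ]
    (M₁ M₂ : Ω → ℝ) (hM₁ : Measurable M₁) (hM₂ : Measurable M₂)
    (hindep : IndepFun M₁ M₂ μ)
    (g₁ g₂ : ℝ → ℝ)
    (hg₁_meas : Measurable g₁) (hg₂_meas : Measurable g₂)
    (hg₁_nonneg : ∀ m, 0 ≤ g₁ m) (hg₂_nonneg : ∀ m, 0 ≤ g₂ m)
    (hg₁_one : ∫ m, g₁ m = 1) (hg₂_one : ∫ m, g₂ m = 1)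
    (hg₁_sym : ∀ m : ℝ, g₁ (-m) = Real.exp (-m) * g₁ m)
    (hg₂_sym : ∀ m : ℝ, g₂ (-m) = Real.exp (-m) * g₂ m)
    (hlaw₁ : Measure.map M₁ μ = volume.withDensity (fun m => ENNReal.ofReal (g₁ m)))
    (hlaw₂ : Measure.map M₂ μ = volume.withDensity (fun m => ENNReal.ofReal (g₂ m))) :
    ∫ ω, Real.tanh (|M₁ ω + M₂ ω| / 2) ∂μ
      = ∫ p in {p : ℝ × ℝ | 0 ≤ p.1 + p.2},
          (1 - Real.exp (-(p.1 + p.2))) * g₁ p.1 * g₂ p.2 := by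
  have hint₁ : Integrable g₁ := .of_integral_ne_zero (by simp [hg₁_one])
  have hint₂ : Integrable g₂ := .of_integral_ne_zero (by simp [hg₂_one])
  have hint : Integrable fun p : ℝ × ℝ => g₁ p.1 * g₂ p.2 := hint₁.mul_prod hint₂
  have hlaw : μ.map (fun ω => (M₁ ω, M₂ ω)) =
      volume.withDensity fun p : ℝ × ℝ => ENNReal.ofReal (g₁ p.1 * g₂ p.2) := by
    rw [(indepFun_iff_map_prod_eq_prod_map_map hM₁.aemeasurable hM₂.aemeasurable).1 hindep,
      hlaw₁, hlaw₂, prod_withDensity hg₁_meas.ennreal_ofReal hg₂_meas.ennreal_ofReal]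
    simp only [ENNReal.ofReal_mul (hg₁_nonneg _)]
    rfl
  have hcont : Continuous fun p : ℝ × ℝ => Real.tanh (|p.1 + p.2| / 2) :=
    continuous_tanh_real.comp (by fun_prop)
  calc ∫ ω, Real.tanh (|M₁ ω + M₂ ω| / 2) ∂μ
      = ∫ p, Real.tanh (|p.1 + p.2| / 2) ∂(μ.map fun ω => (M₁ ω, M₂ ω)) :=
        (integral_map (hM₁.prodMk hM₂).aemeasurable hcont.aestronglyMeasurable).symm
    _ = ∫ p : ℝ × ℝ, Real.tanh (|p.1 + p.2| / 2) * (g₁ p.1 * g₂ p.2) := by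
        rw [hlaw, integral_withDensity_eq_integral_toReal_smul (by fun_prop) (by simp)]
        refine integral_congr_ae (.of_forall fun p => ?_)
        simp only [smul_eq_mul,
          ENNReal.toReal_ofReal (mul_nonneg (hg₁_nonneg p.1) (hg₂_nonneg p.2))]
        ring
    _ = _ := by
        rw [integral_tanh_abs_half_mul_eq_setIntegral _ hint fun p => ?_]
        · simp only [mul_assoc]
        · rw [neg_add, Real.exp_add, Prod.fst_neg, Prod.snd_neg, hg₁_sym, hg₂_sym]
          ring
end
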